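/- (Witness protection lemma.) Assume the conventions: X is an infinite, connected, locally finite, vertex-transitive simple graph satisfying (UBQ) with separation constant σ > 0. Let ρ₁, ρ₂ be bi-infinite quasi-geodesics such that the Hausdorff distance between ρ₁(ℤ) and ρ₂(ℤ) is finite, i.e. there is R ≥ 0 with ρ₁(ℤ) ⊆ N_R(ρ₂(ℤ)) and ρ₂(ℤ) ⊆ N_R(ρ₁(ℤ)). If (w₁, w₂) is a pair of witnesses for ρ₁, then there exist t₁, t₂ ∈ ℕ such that the tails w₁′(n) := w₁(t₁ + n) and w₂′(n) := w₂(t₂ + n) form a pair of witnesses for ρ₂. -/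

import Mathlib

open SimpleGraph

/-- Closed `r`-neighbourhood of a set `A` in the graph metric of `X`. -/
def gnbhd {V : Type*} (X : SimpleGraph V) (A : Set V) (r : ℝ) : Set V :=
  {v : V | ∃ a ∈ A, (X.dist v a : ℝ) ≤ r}

/-- The induced subgraph on `Z` is connected. -/
def ConnSet {V : Type*} (X : SimpleGraph V) (Z : Set V) : Prop :=
  (X.induce Z).Connected

/-- `U` is a connected component of the subset `S` of the vertex set: `U` is a
nonempty connected subset of `S` which is maximal among connected subsets of `S`. -/
def IsCompOf {V : Type*} (X : SimpleGraph V) (U S : Set V) : Prop :=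
  U ⊆ S ∧ U.Nonempty ∧ ConnSet X U ∧
    ∀ U' : Set V, U ⊆ U' → U' ⊆ S → ConnSet X U' → U' = U

/-- A subset `Z` is narrow if it is quasi-isometric to a subset of `ℝ`
with respect to the ambient graph metric. -/
def Narrow {V : Type*} (X : SimpleGraph V) (Z : Set V) : Prop :=
  ∃ (lam c : ℝ) (f : Z → ℝ), 1 ≤ lam ∧ 0 ≤ c ∧
    ∀ x y : Z, |f x - f y| ≤ lam * (X.dist x.1 y.1 : ℝ) + c ∧
      (X.dist x.1 y.1 : ℝ) ≤ lam * |f x - f y| + c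

/-- A subset is wide if it is not narrow. -/
def Wide {V : Type*} (X : SimpleGraph V) (Z : Set V) : Prop := ¬ Narrow X Z

/-- `ρ : ℤ → V` is a bi-infinite `(lam, c)`-quasi-geodesic path. -/
def IsBiQG {V : Type*} (X : SimpleGraph V) (lam c : ℝ) (ρ : ℤ → V) : Prop :=
  (∀ n : ℤ, X.Adj (ρ n) (ρ (n + 1))) ∧
    ∀ s t : ℤ, |(s : ℝ) - (t : ℝ)| / lam - c ≤ (X.dist (ρ s) (ρ t) : ℝ)

/-- A bi-infinite quasi-geodesic: a bi-infinite path which is a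
`(lam, c)`-quasi-geodesic for some `lam ≥ 1`, `c ≥ 0`. -/
def IsBiQuasiGeodesic {V : Type*} (X : SimpleGraph V) (ρ : ℤ → V) : Prop :=
  ∃ lam c : ℝ, 1 ≤ lam ∧ 0 ≤ c ∧ IsBiQG X lam c ρ

/-- The subset `S` has exactly two wide connected components. -/
def TwoWideComps {V : Type*} (X : SimpleGraph V) (S : Set V) : Prop :=
  ∃ U₁ U₂ : Set V, U₁ ≠ U₂ ∧
    IsCompOf X U₁ S ∧ IsCompOf X U₂ S ∧ Wide X U₁ ∧ Wide X U₂ ∧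
    ∀ U : Set V, IsCompOf X U S → Wide X U → U = U₁ ∨ U = U₂

/-- The uniformly bisecting quasi-geodesics property with separation constant `σ`. -/
def UBQ {V : Type*} (X : SimpleGraph V) (σ : ℝ) : Prop :=
  ∀ ρ : ℤ → V, IsBiQuasiGeodesic X ρ →
    TwoWideComps X ((gnbhd X (Set.range ρ) σ)ᶜ)

/-- One-way infinite path. -/
def IsRay {V : Type*} (X : SimpleGraph V) (w : ℕ → V) : Prop :=
  ∀ n : ℕ, X.Adj (w n) (w (n + 1))

/-- `d(w t, A) → ∞` as `t → ∞`. -/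
def DivergesFrom {V : Type*} (X : SimpleGraph V) (w : ℕ → V) (A : Set V) : Prop :=
  ∀ M : ℝ, ∃ N : ℕ, ∀ t : ℕ, N ≤ t → ∀ a ∈ A, M < (X.dist (w t) a : ℝ)

/-- `(w₁, w₂)` is a pair of witnesses for the bi-infinite quasi-geodesic `ρ`:
they are one-way infinite simple paths lying in distinct wide components of the
complement of `N_σ(ρ(ℤ))`, both diverging from `ρ`. -/
def WitnessPair {V : Type*} (X : SimpleGraph V) (σ : ℝ) (ρ : ℤ → V)
    (w₁ w₂ : ℕ → V) : Prop :=
  IsRay X w₁ ∧ Function.Injective w₁ ∧ IsRay X w₂ ∧ Function.Injective w₂ ∧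
  (∃ U₁ U₂ : Set V, U₁ ≠ U₂ ∧
    IsCompOf X U₁ ((gnbhd X (Set.range ρ) σ)ᶜ) ∧ Wide X U₁ ∧
    IsCompOf X U₂ ((gnbhd X (Set.range ρ) σ)ᶜ) ∧ Wide X U₂ ∧
    Set.range w₁ ⊆ U₁ ∧ Set.range w₂ ⊆ U₂) ∧
  DivergesFrom X w₁ (Set.range ρ) ∧ DivergesFrom X w₂ (Set.range ρ)

/-- Concatenation of the reversal of the ray `a` with the ray `b`, as a
bi-infinite path (`t ↦ a (-t)` for `t ≤ 0` and `t ↦ b t` for `t ≥ 0`). -/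
def biconcat {V : Type*} (a b : ℕ → V) : ℤ → V :=
  fun t => if t < 0 then a (-t).toNat else b t.toNat

/-- One-way infinite `(lam, c)`-quasi-geodesic ray. -/
def IsQGRay {V : Type*} (X : SimpleGraph V) (lam c : ℝ) (γ : ℕ → V) : Prop :=
  IsRay X γ ∧
    ∀ s t : ℕ, |(s : ℝ) - (t : ℝ)| / lam - c ≤ (X.dist (γ s) (γ t) : ℝ)

/-- An `(R, r, lam, c)`-cross-examiner, with the three rays `γ i`, the three
witnesses `w i` and the three finite paths `q i` (of length `qn i`) indexed by
`ZMod 3` (where the paper's index `3` corresponds to `0 : ZMod 3`). -/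
def IsCrossExaminer {V : Type*} (X : SimpleGraph V) (σ R r lam c : ℝ) (v₀ : V)
    (γ w : ZMod 3 → ℕ → V) (q : ZMod 3 → ℕ → V) (qn : ZMod 3 → ℕ) : Prop :=
  1 ≤ lam ∧ 0 ≤ c ∧ 10 * σ < r ∧ r < R ∧
  (∀ i : ZMod 3, IsQGRay X lam c (γ i) ∧ γ i 0 = v₀ ∧ IsRay X (w i) ∧
    (∀ j : ℕ, j < qn i → X.Adj (q i j) (q i (j + 1)))) ∧
  ∀ i : ZMod 3,
    -- (CE1)
    IsBiQG X lam c (biconcat (γ (i + 1)) (γ (i + 2))) ∧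
    -- (CE2)
    (∃ U : Set V,
      IsCompOf X U (Set.range (biconcat (γ (i + 1)) (γ (i + 2))) \
        gnbhd X (q 0 '' Set.Iic (qn 0) ∪ q 1 '' Set.Iic (qn 1) ∪ q 2 '' Set.Iic (qn 2))
          (10 * σ)) ∧ w i 0 ∈ U ∧ v₀ ∈ U) ∧
    -- (CE3)
    WitnessPair X σ (biconcat (γ (i + 1)) (γ (i + 2))) (w i) (γ i) ∧
    -- (CE4)
    (∀ t : ℕ, r < (t : ℝ) → ∀ s : ℤ,
      10 * σ < (X.dist (w i t) (biconcat (γ (i + 1)) (γ (i + 2)) s) : ℝ)) ∧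
    -- (CE5)
    (q i 0 ∈ Set.range (γ (i + 1)) ∧ q i (qn i) ∈ Set.range (γ (i + 2)) ∧
      (q i '' Set.Iic (qn i)) ∩
        gnbhd X (Set.range (w (i + 1)) ∪ Set.range (w (i + 2)) ∪ Set.range (γ i))
          (10 * σ) = ∅) ∧
    -- (CE6)
    q i '' Set.Iic (qn i) ⊆ gnbhd X {v₀} (R - 10 * σ) \ gnbhd X {v₀} (r + 10 * σ)

/-- `X` has quadratic growth. -/
def QuadGrowth {V : Type*} (X : SimpleGraph V) : Prop :=
  ∃ C : ℝ, 0 < C ∧ ∀ v : V, ∀ n : ℕ, 1 ≤ n →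
    ({u : V | X.dist u v ≤ n}.ncard : ℝ) ≤ C * (n : ℝ) ^ 2

/-- The set of vertices at distance exactly `1` from `A`. -/
def vertexBoundary {V : Type*} (X : SimpleGraph V) (A : Set V) : Set V :=
  {v : V | v ∉ A ∧ ∃ a ∈ A, X.Adj v a}

/-- The depth of `A`: `inf {r ≥ 0 : A ⊆ N_r(∂A)}`. -/
noncomputable def gdepth {V : Type*} (X : SimpleGraph V) (A : Set V) : ℝ :=
  sInf {r : ℝ | 0 ≤ r ∧ A ⊆ gnbhd X (vertexBoundary X A) r}

/-- A `(lam, c)`-quasi-circle of length `n ≥ 1`: a closed path all of whose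
subpaths of length at most `n / 2` are `(lam, c)`-quasi-geodesics. -/
def IsQuasiCircle {V : Type*} (X : SimpleGraph V) (lam c : ℝ) (n : ℕ)
    (C : ZMod n → V) : Prop :=
  1 ≤ n ∧ (∀ k : ZMod n, X.Adj (C k) (C (k + 1))) ∧
    ∀ (k : ZMod n) (m s t : ℕ), 2 * m ≤ n → s ≤ m → t ≤ m →
      |(s : ℝ) - (t : ℝ)| / lam - c ≤
        (X.dist (C (k + (s : ZMod n))) (C (k + (t : ZMod n))) : ℝ)

/-- A truncated `(lam, c)`-quasi-circle with major face `F` (of length `nF`) and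
minor face `f` (of length `nf`): `F` is the initial part of a `(lam, c)`-quasi-circle
and `f` is a `(lam, c)`-quasi-geodesic with the same endpoints as the remaining part. -/
def IsTruncQuasiCircle {V : Type*} (X : SimpleGraph V) (lam c : ℝ)
    (F : ℕ → V) (nF : ℕ) (f : ℕ → V) (nf : ℕ) : Prop :=
  (∀ i : ℕ, i < nF → X.Adj (F i) (F (i + 1))) ∧
  (∀ i : ℕ, i < nf → X.Adj (f i) (f (i + 1))) ∧
  f 0 = F nF ∧ f nf = F 0 ∧
  (∀ s t : ℕ, s ≤ nf → t ≤ nf →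
    |(s : ℝ) - (t : ℝ)| / lam - c ≤ (X.dist (f s) (f t) : ℝ)) ∧
  ∃ (n : ℕ) (C : ZMod n → V), IsQuasiCircle X lam c n C ∧ nF ≤ n ∧
    ∀ i : ℕ, i ≤ nF → C (i : ZMod n) = F i

/-- The graph `X`, with its graph metric, is quasi-isometric to the metric space `Y`. -/
def QIto {V : Type*} (X : SimpleGraph V) (Y : Type*) [PseudoMetricSpace Y] : Prop :=
  ∃ (lam c : ℝ) (f : V → Y), 1 ≤ lam ∧ 0 ≤ c ∧
    (∀ x x' : V, (X.dist x x' : ℝ) / lam - c ≤ dist (f x) (f x') ∧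
      dist (f x) (f x') ≤ lam * (X.dist x x' : ℝ) + c) ∧
    ∀ y : Y, ∃ x : V, dist y (f x) ≤ c

/-- The Gromov product `(x · y)_w` in the graph metric. -/
noncomputable def gromovProd {V : Type*} (X : SimpleGraph V) (w x y : V) : ℝ :=
  ((X.dist x w : ℝ) + (X.dist y w : ℝ) - (X.dist x y : ℝ)) / 2

/-- `X` is Gromov hyperbolic. -/
def GromovHyperbolic {V : Type*} (X : SimpleGraph V) : Prop :=
  ∃ δ : ℝ, 0 ≤ δ ∧ ∀ w x y z : V,
    min (gromovProd X w x z) (gromovProd X w y z) - δ ≤ gromovProd X w x y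

open Filter Topology Relation

/-- `x` and `y` are linked by a finite path inside `S`. -/
def LinkedIn {V : Type*} (X : SimpleGraph V) (S : Set V) (x y : V) : Prop :=
  ReflTransGen (fun a b => a ∈ S ∧ b ∈ S ∧ X.Adj a b) x y

/-- The set of vertices linked to `x` inside `S`. -/
def pathComp {V : Type*} (X : SimpleGraph V) (S : Set V) (x : V) : Set V :=
  {y | LinkedIn X S x y}

/-- `Z` contains vertices arbitrarily far from `A`. -/
def Deep {V : Type*} (X : SimpleGraph V) (A Z : Set V) : Prop :=
  ∀ M : ℝ, ∃ z ∈ Z, ∀ a ∈ A, M < (X.dist z a : ℝ)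

section Components

variable {V : Type*} {X : SimpleGraph V}

theorem LinkedIn.symm {S : Set V} {x y : V} (h : LinkedIn X S x y) : LinkedIn X S y x := by
  induction h with
  | refl => exact ReflTransGen.refl
  | tail _ hbc ih => exact ReflTransGen.head ⟨hbc.2.1, hbc.1, hbc.2.2.symm⟩ ih

theorem LinkedIn.trans {S : Set V} {x y z : V} (h : LinkedIn X S x y) (h' : LinkedIn X S y z) :
    LinkedIn X S x z :=
  ReflTransGen.trans h h'

theorem LinkedIn.mono {S T : Set V} (hST : S ⊆ T) {x y : V} (h : LinkedIn X S x y) :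
    LinkedIn X T x y := by
  induction h with
  | refl => exact ReflTransGen.refl
  | tail _ hbc ih => exact ReflTransGen.tail ih ⟨hST hbc.1, hST hbc.2.1, hbc.2.2⟩

theorem LinkedIn.mem {S : Set V} {x y : V} (hx : x ∈ S) (h : LinkedIn X S x y) : y ∈ S := by
  induction h with
  | refl => exact hx
  | tail _ hbc _ => exact hbc.2.1

theorem LinkedIn.exists_finite {S : Set V} {x y : V} (hx : x ∈ S) (h : LinkedIn X S x y) :
    ∃ p : Set V, p.Finite ∧ p ⊆ S ∧ x ∈ p ∧ LinkedIn X p x y := by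
  induction h with
  | refl => exact ⟨{x}, Set.finite_singleton x, by simpa using hx, rfl, ReflTransGen.refl⟩
  | @tail b c hab hbc ih =>
    obtain ⟨p, hp, hpS, hxp, hj⟩ := ih
    refine ⟨insert c p, hp.insert c, Set.insert_subset hbc.2.1 hpS, Set.mem_insert_of_mem _ hxp,
      ReflTransGen.tail (hj.mono (Set.subset_insert c p)) ?_⟩
    exact ⟨Set.mem_insert_of_mem _ (hj.mem hxp), Set.mem_insert _ _, hbc.2.2⟩

theorem linkedIn_of_walk {S : Set V} {x y : V} (p : X.Walk x y) (hp : ∀ v ∈ p.support, v ∈ S) :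
    LinkedIn X S x y := by
  induction p with
  | nil => exact ReflTransGen.refl
  | cons h p ih =>
    refine ReflTransGen.head ⟨hp _ (by simp), hp _ (by simp), h⟩ (ih fun v hv => hp v ?_)
    simp [hv]

theorem ConnSet.linkedIn {U : Set V} (hU : ConnSet X U) {x y : V} (hx : x ∈ U) (hy : y ∈ U) :
    LinkedIn X U x y := by
  have h := (SimpleGraph.reachable_iff_reflTransGen _ _).1 (hU.preconnected ⟨x, hx⟩ ⟨y, hy⟩)
  exact h.lift (p := fun a b => a ∈ U ∧ b ∈ U ∧ X.Adj a b) Subtype.val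
    (fun a b hab => ⟨a.2, b.2, hab⟩)

theorem pathComp_subset {S : Set V} {x : V} (hx : x ∈ S) : pathComp X S x ⊆ S :=
  fun _ hy => LinkedIn.mem hx hy

theorem connSet_pathComp (S : Set V) (x : V) : ConnSet X (pathComp X S x) := by
  have key : ∀ y (hy : LinkedIn X S x y),
      (X.induce (pathComp X S x)).Reachable ⟨x, ReflTransGen.refl⟩ ⟨y, hy⟩ := by
    intro y hy
    induction hy with
    | refl => exact SimpleGraph.Reachable.refl _
    | tail hab hbc ih =>
      refine ih.trans (SimpleGraph.Adj.reachable ?_)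
      exact hbc.2.2
  have : Nonempty (pathComp X S x) := ⟨⟨x, ReflTransGen.refl⟩⟩
  exact ⟨fun a b => (key a.1 a.2).symm.trans (key b.1 b.2)⟩

theorem isCompOf_pathComp {S : Set V} {x : V} (hx : x ∈ S) : IsCompOf X (pathComp X S x) S := by
  refine ⟨pathComp_subset hx, ⟨x, ReflTransGen.refl⟩, connSet_pathComp S x, ?_⟩
  intro U' hU hU'S hconn
  refine Set.Subset.antisymm (fun y hy => ?_) hU
  exact (hconn.linkedIn (hU (show x ∈ pathComp X S x from ReflTransGen.refl)) hy).mono hU'S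

theorem IsCompOf.eq_pathComp {U S : Set V} (hU : IsCompOf X U S) {x : V} (hx : x ∈ U) :
    U = pathComp X S x := by
  refine (hU.2.2.2 _ (fun y hy => ?_) (pathComp_subset (hU.1 hx)) (connSet_pathComp S x)).symm
  exact (hU.2.2.1.linkedIn hx hy).mono hU.1

end Components

section Metric

variable {V : Type*} {X : SimpleGraph V}

theorem cast_dist_triangle (hconn : X.Connected) (u v w : V) :
    (X.dist u w : ℝ) ≤ X.dist u v + X.dist v w := by
  exact_mod_cast hconn.dist_triangle

theorem dist_iso_apply (hconn : X.Connected) (φ : X ≃g X) (u v : V) :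
    X.dist (φ u) (φ v) = X.dist u v := by
  have key : ∀ (ψ : X ≃g X) (a b : V), X.dist (ψ a) (ψ b) ≤ X.dist a b := by
    intro ψ a b
    obtain ⟨p, hp⟩ := hconn.exists_walk_length_eq_dist a b
    have h := SimpleGraph.dist_le (p.map ψ.toHom)
    rw [SimpleGraph.Walk.length_map, hp] at h
    exact h
  refine le_antisymm (key φ u v) ?_
  simpa using key φ.symm (φ u) (φ v)

theorem finite_closedBall (hconn : X.Connected) (hlf : ∀ v : V, (X.neighborSet v).Finite)
    (v : V) (n : ℕ) : {u : V | X.dist v u ≤ n}.Finite := by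
  induction n with
  | zero =>
    refine (Set.finite_singleton v).subset fun u hu => ?_
    have h0 : X.dist v u = 0 := Nat.le_zero.1 hu
    exact (hconn.dist_eq_zero_iff.1 h0).symm
  | succ n ih =>
    refine (ih.union (ih.biUnion fun u _ => hlf u)).subset fun u hu => ?_
    obtain ⟨p, hp⟩ := hconn.exists_walk_length_eq_dist u v
    rw [SimpleGraph.dist_comm] at hp
    cases p with
    | nil => left; simp
    | @cons _ w _ h q =>
      right
      have hq := SimpleGraph.dist_le q
      rw [SimpleGraph.Walk.length_cons] at hp
      have hu' : X.dist v u ≤ n + 1 := hu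
      refine Set.mem_biUnion (x := w) ?_ h.symm
      change X.dist v w ≤ n
      rw [SimpleGraph.dist_comm]
      omega

theorem finite_ball_real (hconn : X.Connected) (hlf : ∀ v : V, (X.neighborSet v).Finite)
    (v : V) (r : ℝ) : {u : V | (X.dist u v : ℝ) ≤ r}.Finite := by
  refine (finite_closedBall hconn hlf v ⌈r⌉₊).subset fun u hu => ?_
  have h : (X.dist u v : ℝ) ≤ (⌈r⌉₊ : ℝ) := le_trans hu (Nat.le_ceil r)
  rw [SimpleGraph.dist_comm] at h
  exact_mod_cast h

theorem linkedIn_of_ball_subset (hconn : X.Connected) {S : Set V} {z y : V} {n : ℕ}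
    (hS : ∀ v, X.dist z v ≤ n → v ∈ S) (hy : X.dist z y ≤ n) : LinkedIn X S z y := by
  classical
  obtain ⟨p, hp⟩ := hconn.exists_walk_length_eq_dist z y
  refine linkedIn_of_walk p fun v hv => hS v ?_
  exact (SimpleGraph.dist_le (p.takeUntil v hv)).trans
    ((p.length_takeUntil_le_length hv).trans (hp.trans_le hy))

end Metric

section Narrowness

variable {V : Type*} {X : SimpleGraph V}

theorem Narrow.subset {Z W : Set V} (hW : Narrow X W) (hZW : Z ⊆ W) : Narrow X Z := by
  obtain ⟨lam, c, f, h1, h2, h⟩ := hW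
  exact ⟨lam, c, fun z => f ⟨z, hZW z.2⟩, h1, h2, fun x y => h ⟨x, hZW x.2⟩ ⟨y, hZW y.2⟩⟩

/-- A narrow set containing translates of all balls forces the whole graph to be narrow. -/
theorem narrow_univ_of_balls (hconn : X.Connected) (htrans : ∀ u v : V, ∃ φ : X ≃g X, φ u = v)
    {Z : Set V} (hballs : ∀ n : ℕ, ∃ z, ∀ v, X.dist z v ≤ n → v ∈ Z) (hZ : Narrow X Z) :
    Narrow X Set.univ := by
  classical
  obtain ⟨lam, c, f, hlam, hc, hf⟩ := hZ
  choose z hz using hballs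
  obtain ⟨v₀⟩ := hconn.nonempty
  choose φ hφ using fun n => htrans v₀ (z n)
  have hmem : ∀ n x, X.dist v₀ x ≤ n → φ n x ∈ Z := by
    intro n x hx
    refine hz n _ ?_
    rw [← hφ n, dist_iso_apply hconn]
    exact hx
  let F : V → ℝ := fun v => if h : v ∈ Z then f ⟨v, h⟩ else 0
  have hF : ∀ x ∈ Z, ∀ y ∈ Z, |F x - F y| ≤ lam * (X.dist x y : ℝ) + c ∧
      (X.dist x y : ℝ) ≤ lam * |F x - F y| + c := by
    intro x hx y hy
    simpa only [F, dif_pos hx, dif_pos hy] using hf ⟨x, hx⟩ ⟨y, hy⟩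
  let g : ℕ → V → ℝ := fun n x => F (φ n x) - F (φ n v₀)
  have hg : ∀ x y, ∀ᶠ n in (hyperfilter ℕ : Filter ℕ),
      |g n x - g n y| ≤ lam * (X.dist x y : ℝ) + c ∧
      (X.dist x y : ℝ) ≤ lam * |g n x - g n y| + c := by
    intro x y
    refine Nat.hyperfilter_le_atTop ?_
    filter_upwards [eventually_ge_atTop (X.dist v₀ x), eventually_ge_atTop (X.dist v₀ y)]
      with n hnx hny
    have h := hF _ (hmem n x hnx) _ (hmem n y hny)
    rw [dist_iso_apply hconn] at h
    simpa only [g, sub_sub_sub_cancel_right] using h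
  have hlim : ∀ x, ∃ l, Tendsto (fun n => g n x) (hyperfilter ℕ : Filter ℕ) (𝓝 l) := by
    intro x
    have hK : IsCompact (Set.Icc (-(lam * (X.dist x v₀ : ℝ) + c)) (lam * (X.dist x v₀ : ℝ) + c)) :=
      isCompact_Icc
    have hmemK : ∀ᶠ n in (hyperfilter ℕ : Filter ℕ),
        g n x ∈ Set.Icc (-(lam * (X.dist x v₀ : ℝ) + c)) (lam * (X.dist x v₀ : ℝ) + c) := by
      filter_upwards [hg x v₀] with n hn
      have h0 : g n v₀ = 0 := sub_self _
      rw [h0, sub_zero] at hn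
      exact abs_le.1 hn.1
    obtain ⟨l, -, hl⟩ := hK.ultrafilter_le_nhds ((hyperfilter ℕ).map fun n => g n x)
      (le_principal_iff.2 hmemK)
    exact ⟨l, hl⟩
  choose G hG using hlim
  refine ⟨lam, c, fun x => G x.1, hlam, hc, fun x y => ?_⟩
  have ht : Tendsto (fun n => |g n x - g n y|) (hyperfilter ℕ : Filter ℕ) (𝓝 |G x - G y|) :=
    ((hG x).sub (hG y)).abs
  exact ⟨le_of_tendsto ht ((hg x y).mono fun _ h => h.1),
    ge_of_tendsto ((ht.const_mul lam).add_const c) ((hg x y).mono fun _ h => h.2)⟩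

theorem narrow_of_not_deep (hconn : X.Connected) {ρ : ℤ → V} (hρ : IsBiQuasiGeodesic X ρ)
    {Z : Set V} (hZ : ¬ Deep X (Set.range ρ) Z) : Narrow X Z := by
  obtain ⟨lam, c, hlam, hc, hadj, hqg⟩ := hρ
  have hlip : ∀ (s : ℤ) (k : ℕ), X.dist (ρ s) (ρ (s + k)) ≤ k := by
    intro s k
    induction k with
    | zero => simp
    | succ k ih =>
      have h1 := SimpleGraph.dist_eq_one_iff_adj.2 (hadj (s + k))
      have h2 := hconn.dist_triangle (u := ρ s) (v := ρ (s + k)) (w := ρ (s + k + 1))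
      push_cast
      rw [← add_assoc]
      omega
  have hlip' : ∀ s t : ℤ, (X.dist (ρ s) (ρ t) : ℝ) ≤ |(s : ℝ) - t| := by
    have aux : ∀ s t : ℤ, s ≤ t → (X.dist (ρ s) (ρ t) : ℝ) ≤ |(s : ℝ) - t| := by
      intro s t hst
      obtain ⟨k, rfl⟩ := Int.le.dest hst
      have h : (X.dist (ρ s) (ρ (s + k)) : ℝ) ≤ k := by exact_mod_cast hlip s k
      simpa using h
    intro s t
    rcases le_total s t with h | h
    · exact aux s t h
    · rw [SimpleGraph.dist_comm, abs_sub_comm]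
      exact aux t s h
  unfold Deep at hZ
  push Not at hZ
  obtain ⟨M, hM⟩ := hZ
  have hM' : ∀ z : Z, ∃ n : ℤ, (X.dist z.1 (ρ n) : ℝ) ≤ M := by
    intro z
    obtain ⟨_, ⟨n, rfl⟩, hn⟩ := hM z z.2
    exact ⟨n, hn⟩
  choose f hf using hM'
  have hlam0 : 0 < lam := by linarith
  refine ⟨lam, lam * (2 * |M| + c) + 2 * |M|, fun z => (f z : ℝ), hlam, by positivity,
    fun x y => ?_⟩
  have hx := (hf x).trans (le_abs_self M)
  have hy := (hf y).trans (le_abs_self M)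
  have hx' := hx
  have hy' := hy
  rw [SimpleGraph.dist_comm] at hx' hy'
  constructor
  · have h1 := hqg (f x) (f y)
    have h2 := cast_dist_triangle hconn (ρ (f x)) x (ρ (f y))
    have h3 := cast_dist_triangle hconn x.1 y (ρ (f y))
    have h4 : |(f x : ℝ) - f y| / lam ≤ X.dist x.1 y.1 + (2 * |M| + c) := by linarith
    rw [div_le_iff₀ hlam0] at h4
    have := abs_nonneg M
    linarith
  · have h1 := hlip' (f x) (f y)
    have h2 := cast_dist_triangle hconn x.1 (ρ (f x)) y
    have h3 := cast_dist_triangle hconn (ρ (f x)) (ρ (f y)) y.1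
    have h4 : |(f x : ℝ) - f y| ≤ lam * |(f x : ℝ) - f y| :=
      le_mul_of_one_le_left (abs_nonneg _) hlam
    have h5 : 0 ≤ lam * (2 * |M| + c) := by positivity
    linarith

theorem wide_pathComp_of_deep (hconn : X.Connected)
    (htrans : ∀ u v : V, ∃ φ : X ≃g X, φ u = v) (hwide : Wide X Set.univ)
    {A S : Set V} {D : ℝ} (hS : ∀ v, (∀ a ∈ A, D < (X.dist v a : ℝ)) → v ∈ S) {x : V}
    (hdeep : Deep X A (pathComp X S x)) : Wide X (pathComp X S x) := by
  intro hn
  refine hwide (narrow_univ_of_balls hconn htrans (fun n => ?_) hn)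
  obtain ⟨z, hz, hfar⟩ := hdeep (D + n)
  refine ⟨z, fun v hv => LinkedIn.trans hz (linkedIn_of_ball_subset hconn (fun u hu => hS u ?_) hv)⟩
  intro a ha
  have h1 := hfar a ha
  have h2 := cast_dist_triangle hconn z u a
  have h3 : (X.dist z u : ℝ) ≤ n := by exact_mod_cast hu
  linarith

/-- A deep component remains deep somewhere after deleting a finite set of vertices. -/
theorem exists_deep_pathComp (hlf : ∀ v : V, (X.neighborSet v).Finite)
    {A S T : Set V} (hST : (T \ S).Finite) {x₀ : V} (hx₀ : x₀ ∈ T)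
    (hA : A.Nonempty) (hdeep : Deep X A (pathComp X T x₀)) :
    ∃ f ∈ pathComp X T x₀, f ∈ S ∧ Deep X A (pathComp X S f) := by
  by_contra hcon
  push Not at hcon
  have hbound : ∀ f, ∃ M : ℝ, f ∈ pathComp X T x₀ → f ∈ S →
      ∀ y ∈ pathComp X S f, ∃ a ∈ A, (X.dist y a : ℝ) ≤ M := by
    intro f
    by_cases h : f ∈ pathComp X T x₀ ∧ f ∈ S
    · have h' := hcon f h.1 h.2
      unfold Deep at h'
      push Not at h'
      obtain ⟨M, hM⟩ := h'
      exact ⟨M, fun _ _ => hM⟩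
    · exact ⟨0, fun h1 h2 => absurd ⟨h1, h2⟩ h⟩
  choose M hM using hbound
  let F : Set V := insert x₀ (⋃ e ∈ T \ S, X.neighborSet e)
  have hF : F.Finite := (hST.biUnion fun e _ => hlf e).insert x₀
  have hcover : ∀ y ∈ pathComp X T x₀, y ∈ T \ S ∨
      ∃ f ∈ F, f ∈ pathComp X T x₀ ∧ f ∈ S ∧ y ∈ pathComp X S f := by
    intro y hy
    have hy' : LinkedIn X T x₀ y := hy
    clear hy
    induction hy' with
    | refl =>
      by_cases h : x₀ ∈ S
      · exact Or.inr ⟨x₀, Set.mem_insert _ _, ReflTransGen.refl, h, ReflTransGen.refl⟩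
      · exact Or.inl ⟨hx₀, h⟩
    | @tail b y hab hby ih =>
      by_cases h : y ∈ S
      · right
        rcases ih with hb | ⟨f, hfF, hfW, hfS, hfb⟩
        · exact ⟨y, Set.mem_insert_of_mem _ (Set.mem_biUnion hb hby.2.2),
            ReflTransGen.tail hab hby, h, ReflTransGen.refl⟩
        · exact ⟨f, hfF, hfW, hfS, ReflTransGen.tail hfb ⟨LinkedIn.mem hfS hfb, h, hby.2.2⟩⟩
      · exact Or.inl ⟨hby.2.1, h⟩
  obtain ⟨a₀, ha₀⟩ := hA
  obtain ⟨b₁, hb₁⟩ := (hST.image fun e => (X.dist e a₀ : ℝ)).bddAbove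
  obtain ⟨b₂, hb₂⟩ := (hF.image M).bddAbove
  obtain ⟨y, hy, hfar⟩ := hdeep (max b₁ b₂)
  rcases hcover y hy with h | ⟨f, hfF, hfW, hfS, hfy⟩
  · have h1 := hb₁ (Set.mem_image_of_mem _ h)
    exact absurd (hfar a₀ ha₀) (not_lt.2 (h1.trans (le_max_left _ _)))
  · obtain ⟨a, ha, hle⟩ := hM f hfW hfS y hfy
    have h1 := hb₂ (Set.mem_image_of_mem _ hfF)
    exact absurd (hfar a ha) (not_lt.2 (hle.trans (h1.trans (le_max_right _ _))))

end Narrowness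

section Fattening

variable {V : Type*} {X : SimpleGraph V}

theorem exists_covering_closed_walk (hconn : X.Connected) (v : V) {F : Set V} (hF : F.Finite) :
    ∃ p : X.Walk v v, ∀ u ∈ F, u ∈ p.support := by
  induction F, hF using Set.Finite.induction_on with
  | empty => exact ⟨SimpleGraph.Walk.nil, by simp⟩
  | @insert a s _ _ ih =>
    obtain ⟨p, hp⟩ := ih
    obtain ⟨q⟩ := hconn.preconnected v a
    refine ⟨p.append (q.append q.reverse), fun u hu => ?_⟩
    rcases hu with rfl | hu
    · simp [SimpleGraph.Walk.mem_support_append_iff]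
    · simp [SimpleGraph.Walk.mem_support_append_iff, hp u hu]

/-- All balls of radius `k` are covered by closed walks of one common even length. -/
theorem exists_covering_loops (hconn : X.Connected) (hlf : ∀ v : V, (X.neighborSet v).Finite)
    (htrans : ∀ u v : V, ∃ φ : X ≃g X, φ u = v) (k : ℕ) :
    ∃ m : ℕ, ∀ v : V, ∃ l : ℕ → V, l 0 = v ∧ l (2 * m) = v ∧
      (∀ j < 2 * m, X.Adj (l j) (l (j + 1))) ∧
      ∀ u, X.dist v u ≤ k → ∃ j ≤ 2 * m, l j = u := by
  obtain ⟨v₀⟩ := hconn.nonempty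
  obtain ⟨p, hp⟩ := exists_covering_closed_walk hconn v₀ (finite_closedBall hconn hlf v₀ k)
  have hlen : (p.append p).length = 2 * p.length := by
    rw [SimpleGraph.Walk.length_append, two_mul]
  refine ⟨p.length, fun v => ?_⟩
  obtain ⟨φ, hφ⟩ := htrans v₀ v
  refine ⟨fun j => φ ((p.append p).getVert j), ?_, ?_, ?_, ?_⟩
  · simpa using hφ
  · simp only [← hlen, SimpleGraph.Walk.getVert_length]
    exact hφ
  · intro j hj
    rw [← hlen] at hj
    exact φ.map_adj_iff.2 ((p.append p).adj_getVert_succ hj)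
  · intro u hu
    have h : φ.symm u ∈ (p.append p).support := by
      rw [SimpleGraph.Walk.mem_support_append_iff]
      refine Or.inl (hp _ ?_)
      change X.dist v₀ (φ.symm u) ≤ k
      rw [← dist_iso_apply hconn φ, hφ]
      simpa using hu
    obtain ⟨j, hj, hjl⟩ := SimpleGraph.Walk.mem_support_iff_exists_getVert.1 h
    refine ⟨j, hlen ▸ hjl, ?_⟩
    simp [hj]

/-- The path which follows `ρ` and runs through the loop `l n` when visiting `ρ n`. -/
def withLoops (m : ℕ) (l : ℤ → ℕ → V) (t : ℤ) : V :=
  l (t / (2 * m + 1 : ℕ)) (t % (2 * m + 1 : ℕ)).toNat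

theorem withLoops_apply (m : ℕ) (l : ℤ → ℕ → V) (n : ℤ) {j : ℕ} (hj : j ≤ 2 * m) :
    withLoops m l (n * (2 * m + 1 : ℕ) + j) = l n j := by
  have hpos : (0 : ℤ) < (2 * m + 1 : ℕ) := by positivity
  have h1 : (n * (2 * m + 1 : ℕ) + j : ℤ) / (2 * m + 1 : ℕ) = n := by
    rw [add_comm, Int.add_mul_ediv_right _ _ hpos.ne', Int.ediv_eq_zero_of_lt (by positivity)
      (by exact_mod_cast Nat.lt_succ_of_le hj), zero_add]
  have h2 : (n * (2 * m + 1 : ℕ) + j : ℤ) % (2 * m + 1 : ℕ) = j := by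
    rw [add_comm, Int.add_mul_emod_self_right, Int.emod_eq_of_lt (by positivity)
      (by exact_mod_cast Nat.lt_succ_of_le hj)]
  rw [withLoops, h1, h2, Int.toNat_natCast]

theorem exists_eq_mul_add (m : ℕ) (t : ℤ) :
    ∃ (n : ℤ) (j : ℕ), j ≤ 2 * m ∧ t = n * (2 * m + 1 : ℕ) + j := by
  have hpos : (0 : ℤ) < (2 * m + 1 : ℕ) := by positivity
  have h0 := Int.emod_nonneg t hpos.ne'
  have h1 := Int.emod_lt_of_pos t hpos
  refine ⟨t / (2 * m + 1 : ℕ), (t % (2 * m + 1 : ℕ)).toNat, by omega, ?_⟩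
  rw [Int.toNat_of_nonneg h0, mul_comm]
  exact (Int.mul_ediv_add_emod t _).symm

theorem dist_loop_le (hconn : X.Connected) {l : ℕ → V} {N : ℕ}
    (hadj : ∀ j < N, X.Adj (l j) (l (j + 1))) {j : ℕ} (hj : j ≤ N) : X.dist (l 0) (l j) ≤ j := by
  induction j with
  | zero => simp
  | succ j ih =>
    have h1 := ih (by omega)
    have h2 := SimpleGraph.dist_eq_one_iff_adj.2 (hadj j hj)
    have h3 := hconn.dist_triangle (u := l 0) (v := l j) (w := l (j + 1))
    omega

theorem isBiQuasiGeodesic_withLoops (hconn : X.Connected) {ρ : ℤ → V}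
    (hρ : IsBiQuasiGeodesic X ρ) {m : ℕ} {l : ℤ → ℕ → V} (h0 : ∀ n, l n 0 = ρ n)
    (h1 : ∀ n, l n (2 * m) = ρ n) (hadj : ∀ n, ∀ j < 2 * m, X.Adj (l n j) (l n (j + 1))) :
    IsBiQuasiGeodesic X (withLoops m l) := by
  obtain ⟨lam, c, hlam, hc, hρadj, hqg⟩ := hρ
  have hlam0 : 0 < lam := by linarith
  have hN : (1 : ℝ) ≤ 2 * m + 1 := by
    have : (0 : ℝ) ≤ m := by positivity
    linarith
  refine ⟨lam * (2 * m + 1), c + 4 * m + 1, ?_, by positivity, ?_, ?_⟩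
  · nlinarith
  · intro t
    obtain ⟨n, j, hj, rfl⟩ := exists_eq_mul_add m t
    rw [withLoops_apply m l n hj]
    rcases hj.lt_or_eq with hlt | rfl
    · have h := withLoops_apply m l n (j := j + 1) hlt
      push_cast at h ⊢
      rw [add_assoc, h]
      exact hadj n j hlt
    · have h := withLoops_apply m l (n + 1) (j := 0) (Nat.zero_le _)
      have he : n * (2 * m + 1 : ℕ) + (2 * m : ℕ) + 1 = (n + 1) * (2 * m + 1 : ℕ) + (0 : ℕ) := by
        push_cast
        ring
      rw [he, h, h0, h1]
      exact hρadj n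
  · intro s t
    obtain ⟨n, j, hj, rfl⟩ := exists_eq_mul_add m s
    obtain ⟨n', j', hj', rfl⟩ := exists_eq_mul_add m t
    rw [withLoops_apply m l n hj, withLoops_apply m l n' hj']
    have e1 : (X.dist (ρ n) (l n j) : ℝ) ≤ 2 * m := by
      rw [← h0]
      exact_mod_cast (dist_loop_le hconn (hadj n) hj).trans hj
    have e2 : (X.dist (l n' j') (ρ n') : ℝ) ≤ 2 * m := by
      rw [← h0, SimpleGraph.dist_comm]
      exact_mod_cast (dist_loop_le hconn (hadj n') hj').trans hj'
    have e3 := hqg n n'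
    have e4 := cast_dist_triangle hconn (ρ n) (l n j) (ρ n')
    have e5 := cast_dist_triangle hconn (l n j) (l n' j') (ρ n')
    have hjr : (j : ℝ) ≤ 2 * m := by exact_mod_cast hj
    have hjr' : (j' : ℝ) ≤ 2 * m := by exact_mod_cast hj'
    have hj0 : (0 : ℝ) ≤ j := by positivity
    have hj0' : (0 : ℝ) ≤ j' := by positivity
    have e6 : |((n * (2 * m + 1 : ℕ) + j : ℤ) : ℝ) - ((n' * (2 * m + 1 : ℕ) + j' : ℤ) : ℝ)|
        ≤ |(n : ℝ) - n'| * (2 * m + 1) + (2 * m + 1) := by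
      have : ((n * (2 * m + 1 : ℕ) + j : ℤ) : ℝ) - ((n' * (2 * m + 1 : ℕ) + j' : ℤ) : ℝ)
          = ((n : ℝ) - n') * (2 * m + 1) + (j - j') := by
        push_cast
        ring
      rw [this]
      refine (abs_add_le _ _).trans ?_
      rw [abs_mul, abs_of_pos (by linarith : (0 : ℝ) < 2 * m + 1)]
      have : |(j : ℝ) - j'| ≤ 2 * m + 1 := abs_le.2 ⟨by linarith, by linarith⟩
      linarith
    have e7 : |((n * (2 * m + 1 : ℕ) + j : ℤ) : ℝ) - ((n' * (2 * m + 1 : ℕ) + j' : ℤ) : ℝ)|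
        / (lam * (2 * m + 1)) ≤ |(n : ℝ) - n'| / lam + 1 := by
      rw [div_le_iff₀ (by positivity)]
      refine e6.trans ?_
      have : (|(n : ℝ) - n'| / lam + 1) * (lam * (2 * m + 1))
          = |(n : ℝ) - n'| * (2 * m + 1) + lam * (2 * m + 1) := by
        field_simp
      rw [this]
      nlinarith
    linarith

theorem range_subset_range_withLoops {ρ : ℤ → V} {m : ℕ} {l : ℤ → ℕ → V}
    (h0 : ∀ n, l n 0 = ρ n) : Set.range ρ ⊆ Set.range (withLoops m l) := by
  rintro _ ⟨n, rfl⟩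
  exact ⟨_, (withLoops_apply m l n (Nat.zero_le _)).trans (h0 n)⟩

/-- The loop of length `2 * m` which runs back and forth along an edge. -/
def zigzag (a b : V) (j : ℕ) : V := if Even j then a else b

theorem zigzag_adj {a b : V} (h : X.Adj a b) (j : ℕ) :
    X.Adj (zigzag a b j) (zigzag a b (j + 1)) := by
  by_cases hj : Even j
  · simpa [zigzag, hj, Nat.even_add_one] using h
  · simpa [zigzag, hj, Nat.even_add_one] using h.symm

end Fattening

section Witnesses

variable {V : Type*} {X : SimpleGraph V}

theorem gnbhd_mono {A B : Set V} (h : A ⊆ B) (r : ℝ) : gnbhd X A r ⊆ gnbhd X B r :=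
  fun _ ⟨a, ha, hd⟩ => ⟨a, h ha, hd⟩

theorem DivergesFrom.of_subset_gnbhd (hconn : X.Connected) {A B : Set V} {R : ℝ} {w : ℕ → V}
    (hBA : B ⊆ gnbhd X A R) (hw : DivergesFrom X w A) : DivergesFrom X w B := by
  intro M
  obtain ⟨N, hN⟩ := hw (M + R)
  refine ⟨N, fun t ht b hb => ?_⟩
  obtain ⟨a, ha, hd⟩ := hBA hb
  have h1 := hN t ht a ha
  have h2 := cast_dist_triangle hconn (w t) b a
  linarith

theorem DivergesFrom.tail {A : Set V} {w : ℕ → V} (hw : DivergesFrom X w A) (t : ℕ) :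
    DivergesFrom X (fun n => w (t + n)) A := by
  intro M
  obtain ⟨N, hN⟩ := hw M
  exact ⟨N, fun s hs => hN (t + s) (by omega)⟩

theorem IsRay.tail {w : ℕ → V} (hw : IsRay X w) (t : ℕ) : IsRay X fun n => w (t + n) :=
  fun n => hw (t + n)

theorem IsRay.linkedIn {w : ℕ → V} (hw : IsRay X w) {S : Set V} (hS : ∀ n, w n ∈ S) (n : ℕ) :
    LinkedIn X S (w 0) (w n) := by
  induction n with
  | zero => exact ReflTransGen.refl
  | succ n ih => exact ReflTransGen.tail ih ⟨hS n, hS (n + 1), hw n⟩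

theorem IsRay.deep_pathComp {w : ℕ → V} (hw : IsRay X w) {S A : Set V} (hS : ∀ n, w n ∈ S)
    (hdiv : DivergesFrom X w A) : Deep X A (pathComp X S (w 0)) := by
  intro M
  obtain ⟨N, hN⟩ := hdiv M
  exact ⟨w N, hw.linkedIn hS N, hN N le_rfl⟩

theorem UBQ.wide_univ {σ : ℝ} (hubq : UBQ X σ) {ρ : ℤ → V} (hρ : IsBiQuasiGeodesic X ρ) :
    Wide X Set.univ := by
  obtain ⟨U, -, -, -, -, hU, -⟩ := hubq ρ hρ
  exact fun h => hU (h.subset (Set.subset_univ U))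

/-- If the complement of `N_σ(ρ')` has precisely the wide components of `x₁` and `x₂`, then
enlarging it by finitely many vertices to the complement of `N_σ(ρ'')` cannot link
`x₁` and `x₂`. -/
theorem not_linkedIn_of_finite_diff (hconn : X.Connected)
    (hlf : ∀ v : V, (X.neighborSet v).Finite)
    (htrans : ∀ u v : V, ∃ φ : X ≃g X, φ u = v) {σ : ℝ} (hubq : UBQ X σ)
    {ρ ρ' ρ'' : ℤ → V} (hρ : IsBiQuasiGeodesic X ρ) (hρ' : IsBiQuasiGeodesic X ρ')
    (hρ'' : IsBiQuasiGeodesic X ρ'') {D : ℝ}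
    (hfar : ∀ v, (∀ a ∈ Set.range ρ, D < (X.dist v a : ℝ)) →
      v ∈ (gnbhd X (Set.range ρ') σ)ᶜ)
    (hsub : Set.range ρ'' ⊆ Set.range ρ')
    (hfin : ((gnbhd X (Set.range ρ'') σ)ᶜ \ (gnbhd X (Set.range ρ') σ)ᶜ).Finite)
    {x₁ x₂ : V} (hx₁ : x₁ ∈ (gnbhd X (Set.range ρ') σ)ᶜ)
    (hx₂ : x₂ ∈ (gnbhd X (Set.range ρ') σ)ᶜ)
    (hd₁ : Deep X (Set.range ρ) (pathComp X (gnbhd X (Set.range ρ') σ)ᶜ x₁))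
    (hd₂ : Deep X (Set.range ρ) (pathComp X (gnbhd X (Set.range ρ') σ)ᶜ x₂))
    (hne : ¬ LinkedIn X (gnbhd X (Set.range ρ') σ)ᶜ x₁ x₂) :
    ¬ LinkedIn X (gnbhd X (Set.range ρ'') σ)ᶜ x₁ x₂ := by
  intro hlink
  have hST : (gnbhd X (Set.range ρ') σ)ᶜ ⊆ (gnbhd X (Set.range ρ'') σ)ᶜ :=
    Set.compl_subset_compl.2 (gnbhd_mono hsub σ)
  have huniv := hubq.wide_univ hρ
  have hwide : ∀ x, Deep X (Set.range ρ) (pathComp X (gnbhd X (Set.range ρ') σ)ᶜ x) →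
      Wide X (pathComp X (gnbhd X (Set.range ρ') σ)ᶜ x) :=
    fun x hx => wide_pathComp_of_deep hconn htrans huniv hfar hx
  have hwides : ∀ f ∈ (gnbhd X (Set.range ρ') σ)ᶜ,
      Deep X (Set.range ρ) (pathComp X (gnbhd X (Set.range ρ') σ)ᶜ f) →
      LinkedIn X (gnbhd X (Set.range ρ') σ)ᶜ f x₁ ∨
        LinkedIn X (gnbhd X (Set.range ρ') σ)ᶜ f x₂ := by
    intro f hf hfd
    obtain ⟨U₁, U₂, -, -, -, -, -, hall⟩ := hubq ρ' hρ'
    have heq : ∀ {x y}, pathComp X (gnbhd X (Set.range ρ') σ)ᶜ x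
        = pathComp X (gnbhd X (Set.range ρ') σ)ᶜ y →
        LinkedIn X (gnbhd X (Set.range ρ') σ)ᶜ x y := by
      intro x y h
      change y ∈ pathComp X (gnbhd X (Set.range ρ') σ)ᶜ x
      rw [h]
      exact ReflTransGen.refl
    have c1 := hall _ (isCompOf_pathComp hx₁) (hwide _ hd₁)
    have c2 := hall _ (isCompOf_pathComp hx₂) (hwide _ hd₂)
    have c3 := hall _ (isCompOf_pathComp hf) (hwide _ hfd)
    rcases c1 with c1 | c1 <;> rcases c2 with c2 | c2
    · exact absurd (heq (c1.trans c2.symm)) hne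
    · rcases c3 with c3 | c3
      · exact Or.inl (heq (c3.trans c1.symm))
      · exact Or.inr (heq (c3.trans c2.symm))
    · rcases c3 with c3 | c3
      · exact Or.inr (heq (c3.trans c2.symm))
      · exact Or.inl (heq (c3.trans c1.symm))
    · exact absurd (heq (c1.trans c2.symm)) hne
  have hmem : ∀ W : Set V, IsCompOf X W (gnbhd X (Set.range ρ'') σ)ᶜ → Wide X W →
      W = pathComp X (gnbhd X (Set.range ρ'') σ)ᶜ x₁ := by
    intro W hW hWw
    obtain ⟨x₀, hx₀⟩ := hW.2.1
    have hWeq := hW.eq_pathComp hx₀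
    have hWd : Deep X (Set.range ρ) W := by
      by_contra h
      exact hWw (narrow_of_not_deep hconn hρ h)
    rw [hWeq] at hWd
    obtain ⟨f, hfW, hfS, hfd⟩ :=
      exists_deep_pathComp hlf hfin (hW.1 hx₀) (Set.range_nonempty ρ) hWd
    refine hW.eq_pathComp ?_
    rw [hWeq]
    rcases hwides f hfS hfd with h | h
    · exact LinkedIn.trans hfW (h.mono hST)
    · exact LinkedIn.trans hfW ((h.mono hST).trans hlink.symm)
  obtain ⟨W₁, W₂, hW, hW₁, hW₂, hw₁, hw₂, -⟩ := hubq ρ'' hρ''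
  exact hW ((hmem W₁ hW₁ hw₁).trans (hmem W₂ hW₂ hw₂).symm)

/-- Any finite neighbourhood of a quasi-geodesic can be absorbed into a larger quasi-geodesic
`ρ'` which stays close to `ρ`; moreover the extra part of `ρ'` can be cut away near a finite
set avoiding `N_σ(ρ)`, at the cost of finitely many vertices of the neighbourhood. -/
theorem exists_fattening (hconn : X.Connected) (hlf : ∀ v : V, (X.neighborSet v).Finite)
    (htrans : ∀ u v : V, ∃ φ : X ≃g X, φ u = v) {ρ : ℤ → V} (hρ : IsBiQuasiGeodesic X ρ)
    (σ R : ℝ) :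
    ∃ (ρ' : ℤ → V) (C : ℝ), IsBiQuasiGeodesic X ρ' ∧
      Set.range ρ ⊆ Set.range ρ' ∧ gnbhd X (Set.range ρ) R ⊆ Set.range ρ' ∧
      Set.range ρ' ⊆ gnbhd X (Set.range ρ) C ∧
      ∀ p : Set V, p.Finite → p ⊆ (gnbhd X (Set.range ρ) σ)ᶜ →
        ∃ ρ'' : ℤ → V, IsBiQuasiGeodesic X ρ'' ∧ Set.range ρ'' ⊆ Set.range ρ' ∧
          p ⊆ (gnbhd X (Set.range ρ'') σ)ᶜ ∧
          ((gnbhd X (Set.range ρ'') σ)ᶜ \ (gnbhd X (Set.range ρ') σ)ᶜ).Finite := by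
  classical
  obtain ⟨m, hm⟩ := exists_covering_loops hconn hlf htrans ⌈R⌉₊
  choose L hL0 hL1 hLadj hLcov using hm
  have hclose : ∀ n, ∀ j ≤ 2 * m, (X.dist (L (ρ n) j) (ρ n) : ℝ) ≤ 2 * m := by
    intro n j hj
    have h := dist_loop_le hconn (hLadj (ρ n)) hj
    rw [hL0, SimpleGraph.dist_comm] at h
    exact_mod_cast h.trans hj
  have hrange : Set.range ρ ⊆ Set.range (withLoops m fun n => L (ρ n)) :=
    range_subset_range_withLoops fun n => hL0 (ρ n)
  refine ⟨withLoops m fun n => L (ρ n), 2 * m, isBiQuasiGeodesic_withLoops hconn hρ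
    (fun n => hL0 _) (fun n => hL1 _) (fun n => hLadj _), hrange, ?_, ?_, ?_⟩
  · rintro v ⟨_, ⟨n, rfl⟩, hd⟩
    have h1 : (X.dist v (ρ n) : ℝ) ≤ (⌈R⌉₊ : ℝ) := hd.trans (Nat.le_ceil R)
    rw [SimpleGraph.dist_comm] at h1
    obtain ⟨j, hj, rfl⟩ := hLcov (ρ n) v (by exact_mod_cast h1)
    exact ⟨_, withLoops_apply m _ n hj⟩
  · rintro _ ⟨t, rfl⟩
    obtain ⟨n, j, hj, rfl⟩ := exists_eq_mul_add m t
    rw [withLoops_apply m _ n hj]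
    exact ⟨ρ n, Set.mem_range_self n, hclose n j hj⟩
  · intro p hp hpσ
    let P : ℤ → Prop := fun n => ∀ x ∈ p, σ + 2 * m < (X.dist x (ρ n) : ℝ)
    let l : ℤ → ℕ → V := fun n => if P n then L (ρ n) else zigzag (ρ n) (ρ (n + 1))
    have hlP : ∀ n, P n → l n = L (ρ n) := fun n h => if_pos h
    have hlN : ∀ n, ¬ P n → l n = zigzag (ρ n) (ρ (n + 1)) := fun n h => if_neg h
    have hl : ∀ n j, ¬ P n → l n j ∈ Set.range ρ := by
      intro n j hn
      rw [hlN n hn, zigzag]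
      split_ifs
      · exact Set.mem_range_self n
      · exact Set.mem_range_self (n + 1)
    have hρadj : ∀ n, X.Adj (ρ n) (ρ (n + 1)) := by
      obtain ⟨_, _, _, _, h, _⟩ := hρ
      exact h
    refine ⟨withLoops m l, isBiQuasiGeodesic_withLoops hconn hρ ?_ ?_ ?_, ?_, ?_, ?_⟩
    · intro n
      by_cases hn : P n
      · rw [hlP n hn, hL0]
      · simp [hlN n hn, zigzag]
    · intro n
      by_cases hn : P n
      · rw [hlP n hn, hL1]
      · simp [hlN n hn, zigzag]
    · intro n j hj
      by_cases hn : P n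
      · rw [hlP n hn]
        exact hLadj _ j hj
      · rw [hlN n hn]
        exact zigzag_adj (hρadj n) j
    · rintro _ ⟨t, rfl⟩
      obtain ⟨n, j, hj, rfl⟩ := exists_eq_mul_add m t
      rw [withLoops_apply m _ n hj]
      by_cases hn : P n
      · rw [hlP n hn]
        exact ⟨_, withLoops_apply m _ n hj⟩
      · exact hrange (hl n j hn)
    · rintro x hx ⟨_, ⟨t, rfl⟩, hd⟩
      obtain ⟨n, j, hj, rfl⟩ := exists_eq_mul_add m t
      rw [withLoops_apply m _ n hj] at hd
      by_cases hn : P n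
      · rw [hlP n hn] at hd
        have h1 := hn x hx
        have h2 := hclose n j hj
        have h3 := cast_dist_triangle hconn x (L (ρ n) j) (ρ n)
        linarith
      · exact hpσ hx ⟨_, hl n j hn, hd⟩
    · refine (hp.biUnion fun q _ =>
        finite_ball_real hconn hlf q (σ + 2 * m + (σ + 2 * m))).subset ?_
      rintro x ⟨hx, hx'⟩
      rw [Set.notMem_compl_iff] at hx'
      obtain ⟨_, ⟨t, rfl⟩, hd⟩ := hx'
      obtain ⟨n, j, hj, rfl⟩ := exists_eq_mul_add m t
      rw [withLoops_apply m _ n hj] at hd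
      by_cases hn : P n
      · refine absurd ⟨_, ⟨_, withLoops_apply m l n hj⟩, ?_⟩ hx
        rw [hlP n hn]
        exact hd
      · simp only [P] at hn
        push Not at hn
        obtain ⟨q, hq, hqd⟩ := hn
        refine Set.mem_biUnion hq ?_
        change (X.dist x q : ℝ) ≤ _
        have h1 := hclose n j hj
        have h2 := cast_dist_triangle hconn x (L (ρ n) j) q
        have h3 := cast_dist_triangle hconn (L (ρ n) j) (ρ n) q
        rw [SimpleGraph.dist_comm (u := q)] at hqd
        linarith

end Witnesses

theorem statement_5 {V : Type*} (X : SimpleGraph V)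
    (hinf : Infinite V) (hconn : X.Connected)
    (hlf : ∀ v : V, (X.neighborSet v).Finite)
    (htrans : ∀ u v : V, ∃ φ : X ≃g X, φ u = v)
    (σ : ℝ) (hσ : 0 < σ) (hubq : UBQ X σ)
    (ρ₁ ρ₂ : ℤ → V) (h₁ : IsBiQuasiGeodesic X ρ₁) (h₂ : IsBiQuasiGeodesic X ρ₂)
    (R : ℝ) (hR : 0 ≤ R)
    (hsub₁ : Set.range ρ₁ ⊆ gnbhd X (Set.range ρ₂) R)
    (hsub₂ : Set.range ρ₂ ⊆ gnbhd X (Set.range ρ₁) R)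
    (w₁ w₂ : ℕ → V) (hw : WitnessPair X σ ρ₁ w₁ w₂) :
    ∃ t₁ t₂ : ℕ,
      WitnessPair X σ ρ₂ (fun n => w₁ (t₁ + n)) (fun n => w₂ (t₂ + n)) := by
  obtain ⟨hr₁, hi₁, hr₂, hi₂, ⟨U₁, U₂, hU, hU₁, -, hU₂, -, hwU₁, hwU₂⟩, hdiv₁, hdiv₂⟩ := hw
  replace hdiv₁ := hdiv₁.of_subset_gnbhd hconn hsub₂
  replace hdiv₂ := hdiv₂.of_subset_gnbhd hconn hsub₂
  obtain ⟨ρ', C, hρ', hρ₂ρ', hNρ', hρ'C, hcut⟩ := exists_fattening hconn hlf htrans h₂ σ R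
  have hfar' : ∀ v, (∀ a ∈ Set.range ρ₂, σ + C < (X.dist v a : ℝ)) →
      v ∈ (gnbhd X (Set.range ρ') σ)ᶜ := by
    rintro v hv ⟨b, hb, hbd⟩
    obtain ⟨a, ha, had⟩ := hρ'C hb
    have h3 := cast_dist_triangle hconn v b a
    linarith [hv a ha]
  have hfar₂ : ∀ v, (∀ a ∈ Set.range ρ₂, σ < (X.dist v a : ℝ)) →
      v ∈ (gnbhd X (Set.range ρ₂) σ)ᶜ := by
    rintro v hv ⟨a, ha, had⟩
    exact absurd had (not_le.2 (hv a ha))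
  have hT₁ : (gnbhd X (Set.range ρ') σ)ᶜ ⊆ (gnbhd X (Set.range ρ₁) σ)ᶜ :=
    Set.compl_subset_compl.2 (gnbhd_mono (hsub₁.trans hNρ') σ)
  have hT₂ : (gnbhd X (Set.range ρ') σ)ᶜ ⊆ (gnbhd X (Set.range ρ₂) σ)ᶜ :=
    Set.compl_subset_compl.2 (gnbhd_mono hρ₂ρ' σ)
  obtain ⟨t₁, ht₁⟩ := hdiv₁ (σ + C)
  obtain ⟨t₂, ht₂⟩ := hdiv₂ (σ + C)
  have hm₁ : ∀ n, w₁ (t₁ + n) ∈ (gnbhd X (Set.range ρ') σ)ᶜ :=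
    fun n => hfar' _ (ht₁ _ (Nat.le_add_right _ _))
  have hm₂ : ∀ n, w₂ (t₂ + n) ∈ (gnbhd X (Set.range ρ') σ)ᶜ :=
    fun n => hfar' _ (ht₂ _ (Nat.le_add_right _ _))
  have hray₁ := hr₁.tail t₁
  have hray₂ := hr₂.tail t₂
  have hd₁ := hdiv₁.tail t₁
  have hd₂ := hdiv₂.tail t₂
  have huniv := hubq.wide_univ h₂
  have hsep : ¬ LinkedIn X (gnbhd X (Set.range ρ') σ)ᶜ (w₁ (t₁ + 0)) (w₂ (t₂ + 0)) := by
    intro h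
    refine hU ?_
    have e₁ := hU₁.eq_pathComp (hwU₁ (Set.mem_range_self (t₁ + 0)))
    have hmem : w₂ (t₂ + 0) ∈ U₁ := by
      rw [e₁]
      exact h.mono hT₁
    exact (hU₁.eq_pathComp hmem).trans
      (hU₂.eq_pathComp (hwU₂ (Set.mem_range_self (t₂ + 0)))).symm
  refine ⟨t₁, t₂, hray₁, fun a b h => Nat.add_left_cancel (hi₁ h), hray₂,
    fun a b h => Nat.add_left_cancel (hi₂ h),
    ⟨pathComp X (gnbhd X (Set.range ρ₂) σ)ᶜ (w₁ (t₁ + 0)),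
      pathComp X (gnbhd X (Set.range ρ₂) σ)ᶜ (w₂ (t₂ + 0)), ?_,
      isCompOf_pathComp (hT₂ (hm₁ 0)),
      wide_pathComp_of_deep hconn htrans huniv hfar₂
        (hray₁.deep_pathComp (fun n => hT₂ (hm₁ n)) hd₁),
      isCompOf_pathComp (hT₂ (hm₂ 0)),
      wide_pathComp_of_deep hconn htrans huniv hfar₂
        (hray₂.deep_pathComp (fun n => hT₂ (hm₂ n)) hd₂), ?_, ?_⟩, hd₁, hd₂⟩
  · intro heq
    have hlink : LinkedIn X (gnbhd X (Set.range ρ₂) σ)ᶜ (w₁ (t₁ + 0)) (w₂ (t₂ + 0)) := by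
      change w₂ (t₂ + 0) ∈ pathComp X (gnbhd X (Set.range ρ₂) σ)ᶜ (w₁ (t₁ + 0))
      rw [heq]
      exact ReflTransGen.refl
    obtain ⟨p, hp, hpS, -, hpl⟩ := hlink.exists_finite (hT₂ (hm₁ 0))
    obtain ⟨ρ'', hρ'', hsub, hpρ'', hfin⟩ := hcut p hp hpS
    exact not_linkedIn_of_finite_diff hconn hlf htrans hubq h₂ hρ' hρ'' hfar' hsub hfin
      (hm₁ 0) (hm₂ 0) (hray₁.deep_pathComp hm₁ hd₁) (hray₂.deep_pathComp hm₂ hd₂) hsep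
      (hpl.mono hpρ'')
  · rintro _ ⟨n, rfl⟩
    exact hray₁.linkedIn (fun n => hT₂ (hm₁ n)) n
  · rintro _ ⟨n, rfl⟩
    exact hray₂.linkedIn (fun n => hT₂ (hm₂ n)) n
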